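/- Assume conditions (C1), (C2), (C3) and (C5) hold, λ > 0, and ‖f_j∘ψ_j‖ > 0 for 2 ≤ j ≤ k. Then Σ_{j=2}^k r(f₁, f_j∘ψ_j) ≤ Σ_{j=2}^k r(λf₁ + g₀, f_j∘ψ_j). -/

import Mathlib

noncomputable section

/-- `Ef = ∫₀¹ f(x) dx`. -/
def Emean (f : ℝ → ℝ) : ℝ := ∫ x in (0:ℝ)..1, f x

/-- The centered inner product `⟨f, g⟩ = ∫₀¹ (f(x) − Ef)(g(x) − Eg) dx`. -/
def cinner (f g : ℝ → ℝ) : ℝ := ∫ x in (0:ℝ)..1, (f x - Emean f) * (g x - Emean g)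

/-- The semi-norm `‖f‖ = √⟨f, f⟩`. -/
def cnorm (f : ℝ → ℝ) : ℝ := Real.sqrt (cinner f f)

/-- The similarity `r(f, g) = ⟨f, g⟩ / (‖f‖ ‖g‖)`. -/
def csim (f g : ℝ → ℝ) : ℝ := cinner f g / (cnorm f * cnorm g)

/-- The space `𝓜` of warping functions: continuously differentiable strictly increasing
functions `ψ : [0,1] → [0,1]` with `ψ(0) = 0`, `ψ(1) = 1` whose inverse is also
continuously differentiable.  The inverse is carried explicitly. -/
structure Warp where
  toFun : ℝ → ℝ
  invFun : ℝ → ℝ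
  maps_to : ∀ t ∈ Set.Icc (0:ℝ) 1, toFun t ∈ Set.Icc (0:ℝ) 1
  strictMono : StrictMonoOn toFun (Set.Icc (0:ℝ) 1)
  diff : ∀ t ∈ Set.Icc (0:ℝ) 1, DifferentiableAt ℝ toFun t
  deriv_cont : ContinuousOn (deriv toFun) (Set.Icc (0:ℝ) 1)
  map_zero : toFun 0 = 0
  map_one : toFun 1 = 1
  inv_maps_to : ∀ t ∈ Set.Icc (0:ℝ) 1, invFun t ∈ Set.Icc (0:ℝ) 1
  left_inv : ∀ t ∈ Set.Icc (0:ℝ) 1, invFun (toFun t) = t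
  right_inv : ∀ t ∈ Set.Icc (0:ℝ) 1, toFun (invFun t) = t
  inv_diff : ∀ t ∈ Set.Icc (0:ℝ) 1, DifferentiableAt ℝ invFun t
  inv_deriv_cont : ContinuousOn (deriv invFun) (Set.Icc (0:ℝ) 1)

/-- `E_ψ f = ∫₀¹ f(t) ψ′(t) dt`. -/
def wE (ψ : ℝ → ℝ) (f : ℝ → ℝ) : ℝ := ∫ t in (0:ℝ)..1, f t * deriv ψ t

/-- `⟨f, g⟩_ψ = ∫₀¹ (f(t) − E_ψ f)(g(t) − E_ψ g) ψ′(t) dt`. -/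
def winner (ψ : ℝ → ℝ) (f g : ℝ → ℝ) : ℝ :=
  ∫ t in (0:ℝ)..1, (f t - wE ψ f) * (g t - wE ψ g) * deriv ψ t

/-- `‖f‖_ψ = √⟨f, f⟩_ψ`. -/
def wnorm (ψ : ℝ → ℝ) (f : ℝ → ℝ) : ℝ := Real.sqrt (winner ψ f f)

/-- `ρ*(f, g | ψ) = r(f, g∘ψ) − l₀ ∫₀¹ (ψ′(t) − 1)² dt`. -/
def rhoStar (l₀ : ℝ) (f g : ℝ → ℝ) (ψ : ℝ → ℝ) : ℝ :=
  csim f (g ∘ ψ) - l₀ * ∫ t in (0:ℝ)..1, (deriv ψ t - 1) ^ 2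

/-- `ρ(f, g | ψ) = (ρ*(f, g | ψ) + ρ*(g, f | ψ⁻¹))/2`. -/
def rhoW (l₀ : ℝ) (f g : ℝ → ℝ) (w : Warp) : ℝ :=
  (rhoStar l₀ f g w.toFun + rhoStar l₀ g f w.invFun) / 2

/-- The similarity measure `ρ(f, g) = sup_{ψ ∈ 𝓜} ρ(f, g | ψ)`. -/
def rhoSim (l₀ : ℝ) (f g : ℝ → ℝ) : ℝ := ⨆ w : Warp, rhoW l₀ f g w


theorem Warp.continuousOn (w : Warp) : ContinuousOn w.toFun (Set.Icc (0:ℝ) 1) :=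
  fun t ht => (w.diff t ht).continuousAt.continuousWithinAt

theorem ContinuousOn.intervalIntegrable_zero_one {f : ℝ → ℝ}
    (hf : ContinuousOn f (Set.Icc (0:ℝ) 1)) :
    IntervalIntegrable f MeasureTheory.volume 0 1 :=
  hf.intervalIntegrable_of_Icc zero_le_one

theorem ContinuousOn.fun_const_mul {f : ℝ → ℝ} {S : Set ℝ} (hf : ContinuousOn f S) (c : ℝ) :
    ContinuousOn (fun t => c * f t) S :=
  continuousOn_const.mul hf

theorem Emean_add {f g : ℝ → ℝ} (hf : ContinuousOn f (Set.Icc (0:ℝ) 1))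
    (hg : ContinuousOn g (Set.Icc (0:ℝ) 1)) :
    Emean (fun t => f t + g t) = Emean f + Emean g :=
  intervalIntegral.integral_add hf.intervalIntegrable_zero_one hg.intervalIntegrable_zero_one

theorem Emean_const_mul (c : ℝ) (f : ℝ → ℝ) : Emean (fun t => c * f t) = c * Emean f :=
  intervalIntegral.integral_const_mul c f

theorem cinner_comm (f g : ℝ → ℝ) : cinner f g = cinner g f := by
  simp only [cinner, mul_comm]

theorem cinner_zero_left (h : ℝ → ℝ) : cinner (fun _ => 0) h = 0 := by
  simp [cinner, Emean]

theorem cinner_const_mul_left (c : ℝ) (f h : ℝ → ℝ) :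
    cinner (fun t => c * f t) h = c * cinner f h := by
  simp only [cinner, Emean_const_mul]
  rw [← intervalIntegral.integral_const_mul]
  congr 1
  ext x
  ring

theorem cinner_add_left {f g h : ℝ → ℝ} (hf : ContinuousOn f (Set.Icc (0:ℝ) 1))
    (hg : ContinuousOn g (Set.Icc (0:ℝ) 1)) (hh : ContinuousOn h (Set.Icc (0:ℝ) 1)) :
    cinner (fun t => f t + g t) h = cinner f h + cinner g h := by
  simp only [cinner, Emean_add hf hg]
  rw [← intervalIntegral.integral_add]
  · congr 1
    ext x
    ring
  · exact ((hf.sub continuousOn_const).mul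
      (hh.sub continuousOn_const)).intervalIntegrable_zero_one
  · exact ((hg.sub continuousOn_const).mul
      (hh.sub continuousOn_const)).intervalIntegrable_zero_one

theorem cinner_const_mul_right (c : ℝ) (f h : ℝ → ℝ) :
    cinner h (fun t => c * f t) = c * cinner h f := by
  rw [cinner_comm, cinner_const_mul_left, cinner_comm]

theorem cinner_add_right {f g h : ℝ → ℝ} (hf : ContinuousOn f (Set.Icc (0:ℝ) 1))
    (hg : ContinuousOn g (Set.Icc (0:ℝ) 1)) (hh : ContinuousOn h (Set.Icc (0:ℝ) 1)) :
    cinner h (fun t => f t + g t) = cinner h f + cinner h g := by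
  rw [cinner_comm, cinner_add_left hf hg hh, cinner_comm f, cinner_comm g]

theorem cinner_sum_left {ι : Type*} (I : Finset ι) (c : ι → ℝ) (F : ι → ℝ → ℝ) {h : ℝ → ℝ}
    (hF : ∀ j ∈ I, ContinuousOn (F j) (Set.Icc (0:ℝ) 1))
    (hh : ContinuousOn h (Set.Icc (0:ℝ) 1)) :
    cinner (fun t => ∑ j ∈ I, c j * F j t) h = ∑ j ∈ I, c j * cinner (F j) h := by
  classical
  induction I using Finset.induction_on with
  | empty => simpa using cinner_zero_left h
  | insert i I hi ih =>
    have hI : ∀ j ∈ I, ContinuousOn (F j) (Set.Icc (0:ℝ) 1) :=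
      fun j hj => hF j (Finset.mem_insert_of_mem hj)
    simp only [Finset.sum_insert hi]
    rw [cinner_add_left ((hF i (Finset.mem_insert_self i I)).fun_const_mul _)
      (continuousOn_finsetSum I fun j hj => (hI j hj).fun_const_mul _) hh,
      cinner_const_mul_left, ih hI]

theorem cinner_self_nonneg (f : ℝ → ℝ) : 0 ≤ cinner f f :=
  intervalIntegral.integral_nonneg zero_le_one fun x _ => mul_self_nonneg (f x - Emean f)

theorem cnorm_sq (f : ℝ → ℝ) : cnorm f ^ 2 = cinner f f :=
  Real.sq_sqrt (cinner_self_nonneg f)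

/-- Expansion of `⟨u + c v, u + c v⟩` for the centered inner product. -/
theorem cinner_self_add_const_mul {u v : ℝ → ℝ} (c : ℝ)
    (hu : ContinuousOn u (Set.Icc (0:ℝ) 1)) (hv : ContinuousOn v (Set.Icc (0:ℝ) 1)) :
    cinner (fun t => u t + c * v t) (fun t => u t + c * v t) =
      cinner u u + 2 * c * cinner u v + c ^ 2 * cinner v v := by
  have hcv : ContinuousOn (fun t => c * v t) (Set.Icc (0:ℝ) 1) :=
    hv.fun_const_mul c
  rw [cinner_add_left hu hcv (hu.fun_add hcv), cinner_add_right hu hcv hu,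
    cinner_const_mul_left, cinner_add_right hu hcv hv, cinner_const_mul_right,
    cinner_const_mul_right, cinner_comm v u]
  ring

theorem le_div_sqrt_of_threshold_le {a c N μ : ℝ} (ha : 0 ≤ a) (hc : 0 < c) (hN : 0 ≤ N)
    (hμ : 0 < μ) (h : (N * a ^ 2 - c ^ 2) / (2 * a * c) ≤ μ) :
    a ≤ (μ * a + c) / √(μ ^ 2 + N) := by
  have hpos : 0 < μ ^ 2 + N := by positivity
  rw [le_div_iff₀ (Real.sqrt_pos.2 hpos)]
  refine le_of_sq_le_sq ?_ (by positivity)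
  rw [mul_pow, Real.sq_sqrt hpos.le]
  rcases ha.eq_or_lt with rfl | ha
  · nlinarith
  · rw [div_le_iff₀ (by positivity)] at h
    nlinarith

/-- under (C1), (C2), (C3), (C5), `λ > 0` and `‖fⱼ∘ψⱼ‖ > 0` for
`2 ≤ j ≤ k`, one has `Σⱼ r(f₁, fⱼ∘ψⱼ) ≤ Σⱼ r(λf₁ + g₀, fⱼ∘ψⱼ)`. -/
theorem stmt_4 (k : ℕ) (hk : 2 ≤ k) (f : ℕ → ℝ → ℝ)
    (hf : ∀ j ∈ Finset.Icc 1 k, ContinuousOn (f j) (Set.Icc (0:ℝ) 1))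
    (w : ℕ → Warp)
    (θ : ℕ → ℝ) (hθ : ∀ j ∈ Finset.Icc 2 k, θ j ∈ Set.Icc (0:ℝ) 1)
    (hθsum : ∑ j ∈ Finset.Icc 2 k, θ j = 1)
    (lam : ℝ) (hlam : 0 < lam)
    (g₀ : ℝ → ℝ)
    (hg₀ : g₀ = fun t => ∑ j ∈ Finset.Icc 2 k,
      θ j * (f j ((w j).toFun t) / cnorm (f j ∘ (w j).toFun)))
    (s : ℝ → ℝ)
    (hs : s = fun t => ∑ j ∈ Finset.Icc 2 k,
      f j ((w j).toFun t) / cnorm (f j ∘ (w j).toFun))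
    (s₀ : ℝ → ℝ)
    (hs₀ : s₀ = fun t => ∑ j ∈ Finset.Icc 2 k,
      (f j ((w j).toFun t) - cinner (f j ∘ (w j).toFun) (f 1) * f 1 t) /
        cnorm (f j ∘ (w j).toFun))
    (LC5 : ℝ)
    (hLC5 : LC5 = ((cnorm (fun t => g₀ t - cinner g₀ (f 1) * f 1 t)) ^ 2 *
        (cinner s (f 1)) ^ 2 - (cinner g₀ s₀) ^ 2) /
        (2 * cinner s (f 1) * cinner g₀ s₀) - cinner g₀ (f 1))
    (hC1 : ∀ j ∈ Finset.Icc 1 k, cnorm (f j) = 1)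
    (hC2 : ∀ j ∈ Finset.Icc 2 k, 0 ≤ cinner (f 1) (f j ∘ (w j).toFun))
    (hC3 : 0 < cinner g₀ s₀)
    (hC5 : lam ≥ LC5)
    (hpos : ∀ j ∈ Finset.Icc 2 k, 0 < cnorm (f j ∘ (w j).toFun)) :
    ∑ j ∈ Finset.Icc 2 k, csim (f 1) (f j ∘ (w j).toFun) ≤
      ∑ j ∈ Finset.Icc 2 k, csim (fun t => lam * f 1 t + g₀ t) (f j ∘ (w j).toFun) := by
  set I := Finset.Icc 2 k with hI
  set F : ℕ → ℝ → ℝ := fun j => f j ∘ (w j).toFun with hFdef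
  have hf1 : ContinuousOn (f 1) (Set.Icc (0:ℝ) 1) := hf 1 (Finset.mem_Icc.2 ⟨le_rfl, by omega⟩)
  have hF : ∀ j ∈ I, ContinuousOn (F j) (Set.Icc (0:ℝ) 1) := fun j hj => by
    have hj := Finset.mem_Icc.1 hj
    exact (hf j (Finset.mem_Icc.2 ⟨by omega, hj.2⟩)).comp (w j).continuousOn (w j).maps_to
  have hsum : ∀ c : ℕ → ℝ, ContinuousOn (fun t => ∑ j ∈ I, c j * F j t) (Set.Icc (0:ℝ) 1) :=
    fun c => continuousOn_finsetSum I fun j hj => (hF j hj).fun_const_mul _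
  have hg : g₀ = fun t => ∑ j ∈ I, (θ j * (cnorm (F j))⁻¹) * F j t := by
    rw [hg₀]
    ext t
    refine Finset.sum_congr rfl fun j _ => ?_
    simp only [hFdef, Function.comp_apply]
    ring
  have hs' : s = fun t => ∑ j ∈ I, (cnorm (F j))⁻¹ * F j t := by
    rw [hs]
    ext t
    refine Finset.sum_congr rfl fun j _ => ?_
    simp only [hFdef, Function.comp_apply]
    ring
  have hgc : ContinuousOn g₀ (Set.Icc (0:ℝ) 1) := hg ▸ hsum _
  have hsc : ContinuousOn s (Set.Icc (0:ℝ) 1) := hs' ▸ hsum _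
  have hsh : ∀ h : ℝ → ℝ, ContinuousOn h (Set.Icc (0:ℝ) 1) →
      cinner s h = ∑ j ∈ I, (cnorm (F j))⁻¹ * cinner (F j) h := fun h hh => by
    rw [hs', cinner_sum_left I _ F hF hh]
  have hsim : ∀ h : ℝ → ℝ, ContinuousOn h (Set.Icc (0:ℝ) 1) →
      ∑ j ∈ I, csim h (F j) = cinner s h / cnorm h := fun h hh => by
    rw [hsh h hh, Finset.sum_div]
    refine Finset.sum_congr rfl fun j _ => ?_
    rw [csim, cinner_comm h]
    ring
  have hs₀' : s₀ = fun t => s t + -cinner s (f 1) * f 1 t := by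
    rw [hsh _ hf1, hs', hs₀]
    ext t
    rw [← Finset.sum_neg_distrib, Finset.sum_mul, ← Finset.sum_add_distrib]
    refine Finset.sum_congr rfl fun j _ => ?_
    simp only [hFdef, Function.comp_apply]
    ring
  have hn1 : cnorm (f 1) = 1 := hC1 1 (Finset.mem_Icc.2 ⟨le_rfl, by omega⟩)
  have h11 : cinner (f 1) (f 1) = 1 := by rw [← cnorm_sq, hn1, one_pow]
  have ha : 0 ≤ cinner s (f 1) := by
    rw [hsh _ hf1]
    refine Finset.sum_nonneg fun j hj => mul_nonneg (inv_nonneg.2 (hpos j hj).le) ?_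
    rw [cinner_comm]
    exact hC2 j hj
  have hb : 0 ≤ cinner g₀ (f 1) := by
    rw [hg, cinner_sum_left I _ F hF hf1]
    refine Finset.sum_nonneg fun j hj =>
      mul_nonneg (mul_nonneg (hθ j hj).1 (inv_nonneg.2 (hpos j hj).le)) ?_
    rw [cinner_comm]
    exact hC2 j hj
  have hc : cinner g₀ s₀ = cinner s g₀ - cinner s (f 1) * cinner g₀ (f 1) := by
    rw [hs₀', cinner_add_right hsc (hf1.fun_const_mul _) hgc, cinner_const_mul_right,
      cinner_comm g₀ s]
    ring
  have hN : cnorm (fun t => g₀ t - cinner g₀ (f 1) * f 1 t) ^ 2 =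
      cinner g₀ g₀ - cinner g₀ (f 1) ^ 2 := by
    simp only [sub_eq_add_neg, ← neg_mul]
    rw [cnorm_sq, cinner_self_add_const_mul _ hgc hf1, h11]
    ring
  have hlf : ContinuousOn (fun t => lam * f 1 t) (Set.Icc (0:ℝ) 1) := hf1.fun_const_mul _
  have hnum : cinner s (fun t => lam * f 1 t + g₀ t) =
      (lam + cinner g₀ (f 1)) * cinner s (f 1) + cinner g₀ s₀ := by
    rw [cinner_add_right hlf hgc hsc, cinner_const_mul_right, hc]
    ring
  have hden : cnorm (fun t => lam * f 1 t + g₀ t) = √((lam + cinner g₀ (f 1)) ^ 2 +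
      cnorm (fun t => g₀ t - cinner g₀ (f 1) * f 1 t) ^ 2) := by
    simp only [add_comm (lam * f 1 _)]
    rw [cnorm, cinner_self_add_const_mul lam hgc hf1, h11, hN]
    congr 1
    ring
  change ∑ j ∈ I, csim (f 1) (F j) ≤ ∑ j ∈ I, csim (fun t => lam * f 1 t + g₀ t) (F j)
  rw [hsim _ hf1, hsim _ (hlf.fun_add hgc), hn1, div_one, hnum, hden]
  exact le_div_sqrt_of_threshold_le ha hC3 (sq_nonneg _) (by linarith) (by linarith)

end
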